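/- In a Coxeter system (W, S) with the Bruhat order, an element w ∈ W is dihedral (i.e. lies in some subgroup ⟨s,t⟩ with s, t ∈ S) if and only if w has at most 2 coatoms in the Bruhat order. -/

import Mathlib

open CoxeterSystem Polynomial

section CoxPre

variable {B : Type*} {W : Type*} [Group W] {M : CoxeterMatrix B}

/-- The alternating word of length `n` starting with the letter `i`
(and then alternating between `i` and `j`). -/
def altW (i j : B) : ℕ → List B
  | 0 => []
  | n + 1 => i :: altW j i n

variable (cs : CoxeterSystem M W)

/-- The Bruhat order on a Coxeter group: the reflexive-transitive closure of the
relation `u → u * t` (`t` a reflection) when the length goes up. -/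
def bruhatLE : W → W → Prop :=
  Relation.ReflTransGen
    (fun u v => ∃ t, cs.IsReflection t ∧ v = u * t ∧ cs.length u < cs.length v)

/-- The covering relation of the Bruhat order. -/
def bCov (u v : W) : Prop :=
  bruhatLE cs u v ∧ u ≠ v ∧ ∀ z, bruhatLE cs u z → bruhatLE cs z v → z = u ∨ z = v

/-- The set of coatoms of `v` in the Bruhat order. -/
def bCoat (v : W) : Set W := {x | bCov cs x v}

/-- A partial special matching of `W` equipped with the Bruhat order: a Bruhat order
ideal `dom` together with an involution of it such that `u ⋖ φ u` or `φ u ⋖ u` for all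
`u ∈ dom`, satisfying the coatom condition. -/
structure BSM where
  dom : Set W
  toFun : W → W
  ideal : ∀ ⦃x y : W⦄, y ∈ dom → bruhatLE cs x y → x ∈ dom
  maps : ∀ x ∈ dom, toFun x ∈ dom
  invol : ∀ x ∈ dom, toFun (toFun x) = x
  cov : ∀ x ∈ dom, bCov cs (toFun x) x ∨ bCov cs x (toFun x)
  coatom : ∀ u ∈ dom, bCov cs u (toFun u) →
    bCoat cs (toFun u) =
      {u} ∪ {w | ∃ v, bCov cs v u ∧ bCov cs v (toFun v) ∧ w = toFun v}

/-- The standard dihedral subgroup `⟨s,t⟩` of `W`, as a set. -/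
def dihedral (s t : B) : Set W :=
  (Subgroup.closure {cs.simple s, cs.simple t} : Subgroup W)

/-- `w` is full with respect to `J ⊆ S`: for all distinct `i, j ∈ J`, `m i j < ∞` and the
longest element of `⟨i,j⟩` is `≤ w` in Bruhat order. -/
def IsFullWrt (J : Set B) (w : W) : Prop :=
  ∀ i ∈ J, ∀ j ∈ J, i ≠ j →
    M i j ≠ 0 ∧ bruhatLE cs (cs.wordProd (altW i j (M i j))) w

/-- The standard axioms characterizing the `R`-polynomials of the Hecke algebra of `W`. -/
def RAxioms (R : W → W → Polynomial ℤ) : Prop :=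
  (∀ u, R u u = 1) ∧
  (∀ u v, ¬ bruhatLE cs u v → R u v = 0) ∧
  (∀ (i : B) (x y : W),
      cs.length (cs.simple i * x) = cs.length x + 1 →
      cs.length (cs.simple i * y) = cs.length y + 1 →
      R (cs.simple i * x) (cs.simple i * y) = R x y ∧
      R x (cs.simple i * y) = (X - 1) * R x y + X * R (cs.simple i * x) y) ∧
  (∀ (i : B) (x y : W),
      cs.length (x * cs.simple i) = cs.length x + 1 →
      cs.length (y * cs.simple i) = cs.length y + 1 →
      R (x * cs.simple i) (y * cs.simple i) = R x y ∧
      R x (y * cs.simple i) = (X - 1) * R x y + X * R (x * cs.simple i) y)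

variable {cs}

/-- `ψ` extends the partial special matching `φ`. -/
def BExtends (ψ φ : BSM cs) : Prop :=
  φ.dom ⊆ ψ.dom ∧ ∀ x ∈ φ.dom, ψ.toFun x = φ.toFun x

/-- `φ` is a maximal partial special matching. -/
def BMax (φ : BSM cs) : Prop := ∀ ψ : BSM cs, BExtends ψ φ → ψ.dom = φ.dom

/-- `φ` is `g`-regular on the left: its domain is stable under left multiplication by `g`
and `φ` commutes with left multiplication by `g`. -/
def LeftReg (φ : BSM cs) (g : W) : Prop :=
  (∀ x ∈ φ.dom, g * x ∈ φ.dom) ∧ ∀ x ∈ φ.dom, φ.toFun (g * x) = g * φ.toFun x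

/-- `φ` is `g`-regular on the right. -/
def RightReg (φ : BSM cs) (g : W) : Prop :=
  (∀ x ∈ φ.dom, x * g ∈ φ.dom) ∧ ∀ x ∈ φ.dom, φ.toFun (x * g) = φ.toFun x * g

end CoxPre

namespace CoxeterSystem

variable {B : Type*} {W : Type*} [Group W] {M : CoxeterMatrix B} (cs : CoxeterSystem M W)

section StrongExchange

open Classical in
/-- Conjugation by a simple reflection, recording in the second component whether the conjugated
element is that reflection. -/
noncomputable def signedConj (i : B) : Function.End (W × ZMod 2) :=
  fun p => (cs.simple i * p.1 * cs.simple i, p.2 + if p.1 = cs.simple i then 1 else 0)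

open Classical in
theorem signedConj_mul_pow_apply (i j : B) (n : ℕ) (g : W) (e : ZMod 2) :
    ((cs.signedConj i * cs.signedConj j) ^ n : Function.End (W × ZMod 2)) (g, e) =
      ((cs.simple i * cs.simple j) ^ n * g * ((cs.simple i * cs.simple j) ^ n)⁻¹,
        e + ∑ l ∈ Finset.range (2 * n),
          if g = cs.simple j * (cs.simple i * cs.simple j) ^ l then 1 else 0) := by
  induction n with
  | zero => simp; rfl
  | succ n ih =>
    rw [pow_succ']
    change cs.signedConj i (cs.signedConj j (((cs.signedConj i * cs.signedConj j) ^ n :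
      Function.End (W × ZMod 2)) (g, e))) = _
    rw [ih]
    set r := cs.simple i * cs.simple j with hr
    have hrj : r * cs.simple j * r = cs.simple j := by simp [hr, mul_assoc]
    have hpow : ∀ k : ℕ, r ^ k * cs.simple j * r ^ k = cs.simple j := by
      intro k
      induction k with
      | zero => simp
      | succ k ihk =>
        calc r ^ (k + 1) * cs.simple j * r ^ (k + 1)
            = r ^ k * (r * cs.simple j * r) * r ^ k := by
              rw [pow_succ]; nth_rewrite 2 [← pow_succ]; rw [pow_succ']; simp only [mul_assoc]
          _ = _ := by rw [hrj, ihk]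
    have hconj : ∀ k : ℕ, (r ^ k)⁻¹ * cs.simple j = cs.simple j * r ^ k := by
      intro k
      rw [inv_mul_eq_iff_eq_mul, ← mul_assoc, hpow]
    have h1 : (r ^ n * g * (r ^ n)⁻¹ = cs.simple j) ↔ g = cs.simple j * r ^ (2 * n) := by
      rw [mul_inv_eq_iff_eq_mul, ← eq_inv_mul_iff_mul_eq, ← mul_assoc, hconj, two_mul, pow_add,
        mul_assoc]
    have h2 : (cs.simple j * (r ^ n * g * (r ^ n)⁻¹) * cs.simple j = cs.simple i) ↔
        g = cs.simple j * r ^ (2 * n + 1) := by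
      have e1 : cs.simple j * r ^ (2 * n + 1) =
          (r ^ n)⁻¹ * (cs.simple j * cs.simple i * cs.simple j) * r ^ n := by
        have : cs.simple j * r ^ (2 * n + 1) = cs.simple j * r ^ n * r * r ^ n := by
          simp only [mul_assoc, ← pow_succ', ← pow_add]; congr 2; ring
        rw [this, ← hconj, hr]; simp only [mul_assoc]
      rw [e1]
      constructor
      · intro h; rw [← h]; simp [mul_assoc]
      · intro h; rw [h]; simp [mul_assoc]
    rw [show 2 * (n + 1) = 2 * n + 1 + 1 by ring, Finset.sum_range_succ, Finset.sum_range_succ]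
    simp only [signedConj, h1, h2, Prod.mk.injEq]
    constructor
    · rw [pow_succ', mul_inv_rev]
      simp [hr, mul_assoc]
    · ring

theorem isLiftable_signedConj : M.IsLiftable cs.signedConj := by
  classical
  intro i j
  funext ⟨g, e⟩
  rw [signedConj_mul_pow_apply, cs.simple_mul_simple_pow, two_mul, Finset.sum_range_add]
  simp only [pow_add, cs.simple_mul_simple_pow, one_mul, CharTwo.add_self_eq_zero]
  simp; rfl

/-- The action of the Coxeter group on `W × ZMod 2` extending `signedConj`. -/
noncomputable def signedConjHom : W →* Function.End (W × ZMod 2) :=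
  cs.lift ⟨cs.signedConj, cs.isLiftable_signedConj⟩

theorem signedConjHom_simple (i : B) : cs.signedConjHom (cs.simple i) = cs.signedConj i :=
  cs.lift_apply_simple _ i

open Classical in
theorem signedConjHom_wordProd (ω : List B) (g : W) (e : ZMod 2) :
    cs.signedConjHom (cs.wordProd ω) (g, e) =
      (cs.wordProd ω * g * (cs.wordProd ω)⁻¹, e + ((cs.rightInvSeq ω).count g : ZMod 2)) := by
  induction ω with
  | nil => simp; rfl
  | cons i ω ih =>
    rw [wordProd_cons, map_mul]
    change cs.signedConjHom (cs.simple i) (cs.signedConjHom (cs.wordProd ω) (g, e)) = _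
    rw [ih, signedConjHom_simple, rightInvSeq, List.count_cons]
    have h : (cs.wordProd ω * g * (cs.wordProd ω)⁻¹ = cs.simple i) ↔
        ((cs.wordProd ω)⁻¹ * cs.simple i * cs.wordProd ω = g) := by
      rw [mul_inv_eq_iff_eq_mul, mul_assoc, inv_mul_eq_iff_eq_mul, eq_comm]
    simp only [signedConj, h, Prod.mk.injEq, beq_iff_eq]
    constructor
    · simp [mul_assoc]
    · push_cast; ring

theorem signedConjHom_apply (w g : W) (e : ZMod 2) :
    cs.signedConjHom w (g, e) = (w * g * w⁻¹, e + (cs.signedConjHom w (g, 0)).2) := by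
  obtain ⟨ω, rfl⟩ := cs.wordProd_surjective w
  simp [signedConjHom_wordProd]

theorem signedConjHom_reflection {t : W} (ht : cs.IsReflection t) :
    cs.signedConjHom t (t, 0) = (t, 1) := by
  obtain ⟨u, i, rfl⟩ := ht
  set t := u * cs.simple i * u⁻¹ with hdef
  have hfst : u⁻¹ * t * u⁻¹⁻¹ = cs.simple i := by simp [hdef, mul_assoc]
  have hback : cs.signedConjHom u (cs.signedConjHom u⁻¹ (t, 0)) = (t, 0) := by
    change (cs.signedConjHom u * cs.signedConjHom u⁻¹) (t, 0) = _
    rw [← map_mul]; simp; rfl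
  have happ : cs.signedConjHom t (t, 0) =
      cs.signedConjHom u (cs.signedConjHom (cs.simple i) (cs.signedConjHom u⁻¹ (t, 0))) := by
    rw [hdef, map_mul, map_mul]; rfl
  rw [happ]
  rw [cs.signedConjHom_apply u⁻¹, hfst, cs.signedConjHom_apply u] at hback
  rw [cs.signedConjHom_apply u⁻¹, hfst, signedConjHom_simple]
  simp only [signedConj, if_true, cs.simple_mul_simple_self, one_mul]
  rw [cs.signedConjHom_apply u]
  simp only [Prod.mk.injEq] at hback ⊢
  refine ⟨by simp [hdef], ?_⟩
  linear_combination hback.2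

/-- The strong exchange property, for arbitrary words. -/
theorem exists_eraseIdx_of_length_mul_lt {t : W} (ht : cs.IsReflection t) (ω : List B)
    (hlt : cs.length (cs.wordProd ω * t) < cs.length (cs.wordProd ω)) :
    ∃ k < ω.length, cs.wordProd ω * t = cs.wordProd (ω.eraseIdx k) := by
  classical
  suffices hmem : t ∈ cs.rightInvSeq ω by
    obtain ⟨k, hk, rfl⟩ := List.getElem_of_mem hmem
    refine ⟨k, by simpa using hk, ?_⟩
    rw [← cs.wordProd_mul_getD_rightInvSeq, List.getD_eq_getElem _ _ hk]
  by_contra hmem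
  obtain ⟨μ, hμ, hμw⟩ := cs.exists_isReduced (cs.wordProd ω * t)
  have hω : (cs.signedConjHom (cs.wordProd ω) (t, 0)).2 = 0 := by
    simp [signedConjHom_wordProd, List.count_eq_zero_of_not_mem hmem]
  have hcount : ((cs.rightInvSeq μ).count t : ZMod 2) = 1 := by
    have h1 : (cs.signedConjHom (cs.wordProd ω * t) (t, 0)).2 = 1 := by
      rw [map_mul]
      change (cs.signedConjHom (cs.wordProd ω) (cs.signedConjHom t (t, 0))).2 = 1
      rw [cs.signedConjHom_reflection ht, signedConjHom_apply, hω, add_zero]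
    rw [hμw, signedConjHom_wordProd] at h1
    simpa using h1
  have hmemμ : t ∈ cs.rightInvSeq μ := by
    by_contra h
    simp [List.count_eq_zero_of_not_mem h] at hcount
  have := (cs.isRightInversion_of_mem_rightInvSeq hμ hmemμ).2
  rw [← hμw, mul_assoc, ht.mul_self, mul_one] at this
  omega

end StrongExchange

section Parabolic

variable {cs}

theorem IsReduced.of_append_left {ω μ : List B} (h : cs.IsReduced (ω ++ μ)) : cs.IsReduced ω := by
  simpa using h.take ω.length

theorem IsReduced.of_cons {i : B} {ω : List B} (h : cs.IsReduced (i :: ω)) : cs.IsReduced ω := by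
  simpa using h.drop 1

variable (cs)

theorem wordProd_mem_closure {J : Set B} {ω : List B} (hω : ∀ b ∈ ω, b ∈ J) :
    cs.wordProd ω ∈ Subgroup.closure (cs.simple '' J) := by
  induction ω with
  | nil => simp
  | cons i ω ih =>
    rw [wordProd_cons]
    exact mul_mem (Subgroup.subset_closure ⟨i, hω i (by simp), rfl⟩)
      (ih fun b hb => hω b (by simp [hb]))

theorem exists_isReduced_of_word {J : Set B} (ω : List B) (hω : ∀ b ∈ ω, b ∈ J) :
    ∃ μ : List B, (∀ b ∈ μ, b ∈ J) ∧ cs.IsReduced μ ∧ cs.wordProd μ = cs.wordProd ω := by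
  induction ω using List.reverseRecOn with
  | nil => exact ⟨[], by simp, by simp [IsReduced], rfl⟩
  | append_singleton ω i ih =>
    obtain ⟨μ, hμJ, hμ, hprod⟩ := ih fun b hb => hω b (by simp [hb])
    have hi : i ∈ J := hω i (by simp)
    rcases cs.length_mul_simple (cs.wordProd μ) i with h | h
    · refine ⟨μ ++ [i], ?_, ?_, by simp [wordProd_append, hprod]⟩
      · intro b hb
        rcases List.mem_append.1 hb with hb | hb
        · exact hμJ b hb
        · rwa [List.mem_singleton.1 hb]
      · simp [IsReduced, wordProd_append, h, hμ.eq]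
    · obtain ⟨k, hk, hke⟩ :=
        cs.exists_eraseIdx_of_length_mul_lt (cs.isReflection_simple i) μ (by omega)
      refine ⟨μ.eraseIdx k, fun b hb => hμJ b (List.mem_of_mem_eraseIdx hb), ?_, ?_⟩
      · rw [IsReduced, ← hke, List.length_eraseIdx_of_lt hk, ← hμ.eq]; omega
      · rw [← hke, hprod]; simp [wordProd_append]

theorem exists_isReduced_of_mem_closure {J : Set B} {w : W}
    (hw : w ∈ Subgroup.closure (cs.simple '' J)) :
    ∃ ω : List B, (∀ b ∈ ω, b ∈ J) ∧ cs.IsReduced ω ∧ cs.wordProd ω = w := by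
  suffices h : ∃ ω : List B, (∀ b ∈ ω, b ∈ J) ∧ cs.wordProd ω = w by
    obtain ⟨ω, hω, rfl⟩ := h
    exact cs.exists_isReduced_of_word ω hω
  induction hw using Subgroup.closure_induction with
  | mem x hx =>
    obtain ⟨i, hi, rfl⟩ := hx
    exact ⟨[i], by simpa using hi, by simp⟩
  | one => exact ⟨[], by simp, by simp⟩
  | mul x y _ _ hx hy =>
    obtain ⟨ω, hω, rfl⟩ := hx
    obtain ⟨μ, hμ, rfl⟩ := hy
    refine ⟨ω ++ μ, fun b hb => ?_, by simp [wordProd_append]⟩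
    exact (List.mem_append.1 hb).elim (hω b) (hμ b)
  | inv x _ hx =>
    obtain ⟨ω, hω, rfl⟩ := hx
    exact ⟨ω.reverse, fun b hb => hω b (List.mem_reverse.1 hb), by simp⟩

theorem exists_min_length_coset (J : Set B) (w : W) :
    ∃ u, u⁻¹ * w ∈ Subgroup.closure (cs.simple '' J) ∧
      ∀ x ∈ Subgroup.closure (cs.simple '' J), cs.length u ≤ cs.length (u * x) := by
  obtain ⟨u, hu, hmin⟩ := WellFounded.has_min (measure cs.length).wf
    {u | u⁻¹ * w ∈ Subgroup.closure (cs.simple '' J)} ⟨w, by simp⟩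
  refine ⟨u, hu, fun x hx => not_lt.1 (hmin (u * x) ?_)⟩
  simpa [mul_assoc] using mul_mem (inv_mem hx) hu

/-- Lengths add up along the factorization given by a minimal coset representative. -/
theorem length_mul_wordProd_of_min {J : Set B} {u : W}
    (hu : ∀ x ∈ Subgroup.closure (cs.simple '' J), cs.length u ≤ cs.length (u * x))
    {ω : List B} (hωJ : ∀ b ∈ ω, b ∈ J) (hω : cs.IsReduced ω) :
    cs.length (u * cs.wordProd ω) = cs.length u + ω.length := by
  induction ω using List.reverseRecOn with
  | nil => simp
  | append_singleton ω i ih =>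
    have hωJ' : ∀ b ∈ ω, b ∈ J := fun b hb => hωJ b (by simp [hb])
    have ih := ih hωJ' hω.of_append_left
    have hassoc : u * cs.wordProd (ω ++ [i]) = u * cs.wordProd ω * cs.simple i := by
      simp [wordProd_append, mul_assoc]
    rcases cs.length_mul_simple (u * cs.wordProd ω) i with h | h
    · rw [hassoc, h, ih]; simp; omega
    exfalso
    obtain ⟨μ, hμ, rfl⟩ := cs.exists_isReduced u
    rw [← wordProd_append] at h
    obtain ⟨k, hk, hke⟩ :=
      cs.exists_eraseIdx_of_length_mul_lt (cs.isReflection_simple i) (μ ++ ω) (by omega)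
    by_cases hkμ : k < μ.length
    · rw [List.eraseIdx_append_of_lt_length hkμ, wordProd_append, wordProd_append] at hke
      have hmem : cs.wordProd ω * cs.simple i * (cs.wordProd ω)⁻¹ ∈
          Subgroup.closure (cs.simple '' J) :=
        mul_mem (mul_mem (cs.wordProd_mem_closure hωJ')
          (Subgroup.subset_closure ⟨i, hωJ i (by simp), rfl⟩))
          (inv_mem (cs.wordProd_mem_closure hωJ'))
      have hle := hu _ hmem
      rw [← mul_assoc, ← mul_assoc, hke, mul_inv_cancel_right, hμ.eq] at hle
      have := cs.length_wordProd_le (μ.eraseIdx k)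
      rw [List.length_eraseIdx_of_lt hkμ] at this
      omega
    · push Not at hkμ
      rw [List.eraseIdx_append_of_length_le hkμ, wordProd_append, wordProd_append, mul_assoc,
        mul_right_inj] at hke
      have h1 := hω.eq
      rw [wordProd_append, wordProd_singleton, hke] at h1
      have h2 := cs.length_wordProd_le (ω.eraseIdx (k - μ.length))
      have h3 := List.length_eraseIdx_le ω (k - μ.length)
      simp at h1
      omega

end Parabolic

end CoxeterSystem

section Bruhat

variable {B : Type*} {W : Type*} [Group W] {M : CoxeterMatrix B} (cs : CoxeterSystem M W)

variable {cs} in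
theorem bruhatLE.eq_or_length_lt {u v : W} (h : bruhatLE cs u v) :
    u = v ∨ cs.length u < cs.length v := by
  induction h with
  | refl => exact Or.inl rfl
  | tail _ hstep ih =>
    obtain ⟨t, -, -, hlt⟩ := hstep
    rcases ih with rfl | ih
    · exact Or.inr hlt
    · exact Or.inr (ih.trans hlt)

theorem bruhatLE_of_isReflection {u v : W} (ht : cs.IsReflection (u⁻¹ * v))
    (hlt : cs.length u < cs.length v) : bruhatLE cs u v :=
  Relation.ReflTransGen.single ⟨u⁻¹ * v, ht, by simp, hlt⟩

theorem mem_bCoat_of_isReflection {x w : W} (ht : cs.IsReflection (x⁻¹ * w))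
    (hlen : cs.length x + 1 = cs.length w) : x ∈ bCoat cs w := by
  refine ⟨bruhatLE_of_isReflection cs ht (by omega), ?_, fun z hxz hzw => ?_⟩
  · rintro rfl; omega
  · rcases hxz.eq_or_length_lt with h | h
    · exact Or.inl h.symm
    · rcases hzw.eq_or_length_lt with h' | h'
      · exact Or.inr h'
      · omega

theorem exists_isReflection_of_bCov {x w : W} (h : bCov cs x w) :
    ∃ t, cs.IsReflection t ∧ x = w * t ∧ cs.length x < cs.length w := by
  obtain ⟨hle, hne, hcov⟩ := h
  rcases Relation.ReflTransGen.cases_head hle with h | ⟨z, hstep, hzw⟩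
  · exact absurd h hne
  · rcases hcov z (Relation.ReflTransGen.single hstep) hzw with rfl | rfl
    · obtain ⟨_, _, _, hlt⟩ := hstep
      omega
    · obtain ⟨t, ht, rfl, hlt⟩ := hstep
      exact ⟨t, ht, by rw [mul_assoc, ht.mul_self, mul_one], hlt⟩

theorem bruhatLE_wordProd_append (ω μ : List B) (h : cs.IsReduced (ω ++ μ)) :
    bruhatLE cs (cs.wordProd ω) (cs.wordProd (ω ++ μ)) := by
  induction μ using List.reverseRecOn with
  | nil => rw [List.append_nil]; exact Relation.ReflTransGen.refl
  | append_singleton μ i ih =>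
    rw [← List.append_assoc] at h ⊢
    refine (ih h.of_append_left).tail
      ⟨cs.simple i, cs.isReflection_simple i, by simp [wordProd_append, mul_assoc], ?_⟩
    rw [h.of_append_left.eq, h.eq]
    simp

end Bruhat

section AltW

variable {B : Type*} {W : Type*} [Group W] {M : CoxeterMatrix B} (cs : CoxeterSystem M W)

@[simp] theorem length_altW (a b : B) (n : ℕ) : (altW a b n).length = n := by
  induction n generalizing a b with
  | zero => rfl
  | succ n ih => simp [altW, ih]

theorem exists_altW_append (a b : B) {m n : ℕ} (h : m ≤ n) :
    ∃ μ, altW a b n = altW a b m ++ μ := by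
  induction m generalizing a b n with
  | zero => exact ⟨altW a b n, rfl⟩
  | succ m ih =>
    obtain ⟨n, rfl⟩ : ∃ k, n = k + 1 := ⟨n - 1, by omega⟩
    obtain ⟨μ, hμ⟩ := ih b a (n := n) (by omega)
    exact ⟨μ, by simp [altW, hμ]⟩

theorem eq_altW_of_isReduced {i j : B} {ω : List B} (hω : cs.IsReduced ω)
    (hJ : ∀ b ∈ ω, b ∈ ({i, j} : Set B)) :
    ω = altW i j ω.length ∨ ω = altW j i ω.length := by
  induction ω with
  | nil => exact Or.inl rfl
  | cons c ω ih =>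
    have hhead : ∀ d ω', ω = d :: ω' → c ≠ d := by
      rintro d ω' rfl rfl
      have h1 := hω.eq
      rw [wordProd_cons, wordProd_cons, cs.simple_mul_simple_cancel_left] at h1
      have h2 := cs.length_wordProd_le ω'
      simp at h1
      omega
    have hc := hJ c (by simp)
    rw [List.length_cons]
    generalize ω.length = n at *
    rcases ih hω.of_cons fun b hb => hJ b (by simp [hb]) with h | h <;>
      rcases hc with rfl | hc
    · cases n with
      | zero => left; simp [h, altW]
      | succ n => exact absurd rfl (hhead _ _ h)
    · rw [Set.mem_singleton_iff] at hc
      subst hc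
      right; simp [altW, h]
    · left; simp [altW, h]
    · rw [Set.mem_singleton_iff] at hc
      subst hc
      cases n with
      | zero => right; simp [h, altW]
      | succ n => exact absurd rfl (hhead _ _ h)

theorem bCoat_wordProd_altW_subset (a b : B) (n : ℕ) (hred : cs.IsReduced (altW a b n)) :
    bCoat cs (cs.wordProd (altW a b n)) ⊆
      {cs.wordProd (altW a b (n - 1)), cs.wordProd (altW b a (n - 1))} := by
  intro x hx
  obtain ⟨t, ht, hxt, hlt⟩ := exists_isReflection_of_bCov cs hx
  obtain ⟨k, -, hk⟩ := cs.exists_eraseIdx_of_length_mul_lt ht _ (hxt ▸ hlt)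
  have hletters : ∀ (m : ℕ) (a b c : B), c ∈ altW a b m → c ∈ ({a, b} : Set B) := by
    intro m
    induction m with
    | zero => simp [altW]
    | succ m ih =>
      intro a b c hc
      rcases List.mem_cons.1 hc with rfl | hc
      · simp
      · exact (Set.pair_comm b a) ▸ ih b a c hc
  obtain ⟨ω, hωJ, hω, hωx⟩ := cs.exists_isReduced_of_word ((altW a b n).eraseIdx k)
    fun c hc => hletters n a b c (List.mem_of_mem_eraseIdx hc)
  rw [← hk, ← hxt] at hωx
  have hlen : cs.length x = ω.length := by rw [← hωx, hω.eq]
  have hn : ω.length < n := by rw [hred.eq, length_altW] at hlt; omega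
  obtain ⟨μ, hμ⟩ := exists_altW_append a b (show ω.length + 1 ≤ n by omega)
  have hzred : cs.IsReduced (altW a b (ω.length + 1)) := (hμ ▸ hred).of_append_left
  have hzw : bruhatLE cs (cs.wordProd (altW a b (ω.length + 1))) (cs.wordProd (altW a b n)) := by
    rw [hμ] at hred ⊢
    exact bruhatLE_wordProd_append cs _ _ hred
  have hcases := eq_altW_of_isReduced cs hω hωJ
  have hxz : bruhatLE cs x (cs.wordProd (altW a b (ω.length + 1))) := by
    rcases hcases with h | h
    · obtain ⟨ν, hν⟩ := exists_altW_append a b (show ω.length ≤ ω.length + 1 by omega)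
      rw [hν] at hzred ⊢
      rw [← hωx]
      nth_rewrite 1 [h]
      exact bruhatLE_wordProd_append cs _ _ hzred
    · refine bruhatLE_of_isReflection cs ?_ (by rw [hzred.eq, length_altW]; omega)
      rw [altW, ← h, wordProd_cons, hωx, ← mul_assoc]
      simpa using (cs.isReflection_simple a).conj x⁻¹
  have hzlen := hzred.eq
  rw [length_altW] at hzlen
  have hω' : ω.length = n - 1 := by
    rcases hx.2.2 _ hxz hzw with h | h
    · rw [h] at hzlen; omega
    · rw [h, hred.eq, length_altW] at hzlen; omega
  rw [hω'] at hcases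
  rcases hcases with h | h <;> rw [← hωx, h] <;> simp

end AltW

section Dihedral

variable {B : Type*} {W : Type*} [Group W] {M : CoxeterMatrix B} (cs : CoxeterSystem M W)

theorem dihedral_eq_closure_image (i j : B) :
    dihedral cs i j = (Subgroup.closure (cs.simple '' {i, j}) : Subgroup W) := by
  rw [dihedral, Set.image_pair]

theorem exists_bCoat_subset_pair_of_mem_dihedral {i j : B} {w : W} (hw : w ∈ dihedral cs i j) :
    ∃ x y : W, bCoat cs w ⊆ {x, y} := by
  rw [dihedral_eq_closure_image] at hw
  obtain ⟨ω, hJ, hω, rfl⟩ := cs.exists_isReduced_of_mem_closure hw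
  rcases eq_altW_of_isReduced cs hω hJ with h | h <;> rw [h] at hω ⊢ <;>
    exact ⟨_, _, bCoat_wordProd_altW_subset cs _ _ _ hω⟩

/-- If the last two letters of a reduced word for `w` are `a`, `b` and `w` is not in the subgroup
they generate, then `w` has at least three coatoms. -/
theorem exists_three_bCoat {a b : B} {w : W} (hw : w ∉ dihedral cs a b)
    (hlen : cs.length (w * cs.simple b * cs.simple a) + 2 = cs.length w) :
    ∃ x ∈ bCoat cs w, ∃ y ∈ bCoat cs w, ∃ z ∈ bCoat cs w, x ≠ y ∧ x ≠ z ∧ y ≠ z := by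
  rw [dihedral_eq_closure_image] at hw
  obtain ⟨u, huw, hmin⟩ := cs.exists_min_length_coset {a, b} w
  obtain ⟨ω, hJ, hω, hωv⟩ := cs.exists_isReduced_of_mem_closure huw
  obtain rfl : w = u * cs.wordProd ω := by rw [hωv]; simp
  have hadd := cs.length_mul_wordProd_of_min hmin hJ hω
  have hmemω := cs.wordProd_mem_closure hJ
  have hsimple : ∀ c ∈ ({a, b} : Set B), cs.simple c ∈ Subgroup.closure (cs.simple '' {a, b}) :=
    fun c hc => Subgroup.subset_closure ⟨c, hc, rfl⟩
  have hu1 : u ≠ 1 := by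
    rintro rfl
    exact hw (by simpa using hmemω)
  have hω2 : 2 ≤ ω.length := by
    have := hmin _ (mul_mem (mul_mem hmemω (hsimple b (by simp))) (hsimple a (by simp)))
    simp only [← mul_assoc] at this
    omega
  obtain ⟨r, hr⟩ := cs.exists_leftDescent_of_ne_one hu1
  rw [isLeftDescent_iff] at hr
  obtain ⟨c, mid, d, rfl⟩ : ∃ c mid d, ω = c :: (mid ++ [d]) := by
    obtain ⟨c, ω, rfl⟩ := List.exists_cons_of_length_pos (show 0 < ω.length by omega)
    have hne : ω ≠ [] := by rintro rfl; simp at hω2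
    exact ⟨c, ω.dropLast, ω.getLast hne, by rw [List.dropLast_append_getLast]⟩
  have hJtail : ∀ e ∈ mid ++ [d], e ∈ ({a, b} : Set B) := fun e he =>
    hJ e (List.mem_cons_of_mem _ he)
  have hJinit : ∀ e ∈ c :: mid, e ∈ ({a, b} : Set B) := fun e he =>
    hJ e (by rw [← List.cons_append]; exact List.mem_append_left _ he)
  have htail := cs.length_mul_wordProd_of_min hmin hJtail hω.of_cons
  have hinitRed : cs.IsReduced (c :: mid) := by
    rw [← List.cons_append] at hω
    exact hω.of_append_left
  have hinit := cs.length_mul_wordProd_of_min hmin hJinit hinitRed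
  simp only [List.length_cons, List.length_append, List.length_nil] at hadd htail hinit
  have hnotin : ∀ μ : List B, (∀ e ∈ μ, e ∈ ({a, b} : Set B)) →
      cs.simple r * (u * cs.wordProd (c :: (mid ++ [d]))) ≠ u * cs.wordProd μ := by
    intro μ hμ h
    have := hmin _ (mul_mem (cs.wordProd_mem_closure hμ) (inv_mem hmemω))
    rw [← mul_assoc, ← h, ← mul_assoc, mul_inv_cancel_right] at this
    omega
  refine ⟨_, mem_bCoat_of_isReflection cs (x := cs.simple r * (u * cs.wordProd (c :: (mid ++ [d]))))
    ?_ ?_, _, mem_bCoat_of_isReflection cs (x := u * cs.wordProd (mid ++ [d])) ?_ ?_,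
    _, mem_bCoat_of_isReflection cs (x := u * cs.wordProd (c :: mid)) ?_ ?_,
    hnotin _ hJtail, hnotin _ hJinit, ?_⟩
  · simpa [mul_assoc] using (cs.isReflection_simple r).conj (u * cs.wordProd (c :: (mid ++ [d])))⁻¹
  · have h1 := cs.length_mul_le (cs.simple r * u) (cs.wordProd (c :: (mid ++ [d])))
    rw [mul_assoc, hω.eq] at h1
    simp only [List.length_cons, List.length_append, List.length_nil] at h1
    rcases cs.length_simple_mul (u * cs.wordProd (c :: (mid ++ [d]))) r with h | h <;> omega
  · simpa [mul_assoc, wordProd_cons] using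
      (cs.isReflection_simple c).conj (cs.wordProd (mid ++ [d]))⁻¹
  · omega
  · rw [← List.cons_append, wordProd_append]
    simpa [mul_assoc] using cs.isReflection_simple d
  · omega
  · intro h
    have h1 := hω.eq
    rw [wordProd_cons, mul_left_cancel h, wordProd_cons, cs.simple_mul_simple_cancel_left] at h1
    have h2 := cs.length_wordProd_le mid
    simp at h1
    omega

end Dihedral

/-- an element of a Coxeter group is dihedral iff it has at most two
coatoms in the Bruhat order. -/
theorem stmt2 {B : Type*} {W : Type*} [Group W] {M : CoxeterMatrix B} [Nonempty B]
    (cs : CoxeterSystem M W) (w : W) :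
    (∃ i j : B, w ∈ dihedral cs i j) ↔ (∃ x y : W, bCoat cs w ⊆ {x, y}) := by
  constructor
  · rintro ⟨i, j, hw⟩
    exact exists_bCoat_subset_pair_of_mem_dihedral cs hw
  · rintro ⟨x, y, hxy⟩
    by_cases hw : w = 1
    · obtain ⟨i⟩ := ‹Nonempty B›
      exact ⟨i, i, by rw [hw]; exact one_mem (Subgroup.closure {cs.simple i, cs.simple i})⟩
    obtain ⟨b, hb⟩ := cs.exists_rightDescent_of_ne_one hw
    rw [cs.isRightDescent_iff] at hb
    by_cases hwb : w * cs.simple b = 1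
    · refine ⟨b, b, ?_⟩
      rw [mul_eq_one_iff_eq_inv, cs.inv_simple] at hwb
      rw [hwb]
      exact Subgroup.subset_closure (by simp)
    obtain ⟨a, ha⟩ := cs.exists_rightDescent_of_ne_one hwb
    rw [cs.isRightDescent_iff] at ha
    refine ⟨a, b, ?_⟩
    by_contra hnot
    obtain ⟨p, hp, q, hq, r, hr, hpq, hpr, hqr⟩ := exists_three_bCoat cs hnot (by omega)
    rcases hxy hp with rfl | rfl <;> rcases hxy hq with rfl | rfl <;>
      rcases hxy hr with rfl | rfl <;> simp_all
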